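/- Let L/K be a finite Galois extension with Galois group G, X a topological space, and F a sheaf of L-vector spaces on X equipped with a G-structure (φ_g)_{g∈G}. Let F_K be the subsheaf of K-vector spaces of G-fixed sections, F_K(U) := { s ∈ F(U) : φ_g^U(s) = s for all g ∈ G }. Then for every open U ⊆ X the natural L-linear map L ⊗_K F_K(U) → F(U), l ⊗ s ↦ l • s, is an isomorphism. In particular, F is isomorphic, as a sheaf of L-vector spaces, to the extension of scalars from K to L of the sheaf F_K of K-vector spaces; i.e., F has a K-structure. -/

import Mathlib

open CategoryTheory TopologicalSpace TensorProduct

lemma gal_dual {K L : Type} [Field K] [Field L] [Algebra K L] [FiniteDimensional K L] [IsGalois K L]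
    {ι : Type} [Fintype ι] [DecidableEq ι] (b : Module.Basis ι K L) (g : L ≃ₐ[K] L) [DecidableEq (L ≃ₐ[K] L)] :
    ∑ i, b i * g (b.traceDual i) = if g = 1 then 1 else 0 := by
  let M : Matrix ι (L ≃ₐ[K] L) L := fun i g => g (b.traceDual i)
  let N : Matrix (L ≃ₐ[K] L) ι L := fun g i => g (b i)
  have h1 : M * N = 1 := by
    ext i j
    have := b.trace_traceDual_mul i j
    have h2 := trace_eq_sum_automorphisms (K := K) (L := L) (b.traceDual i * b j)
    rw [this] at h2
    simp only [map_mul] at h2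
    rw [Matrix.mul_apply, Matrix.one_apply]
    simp only [M, N]
    rw [← h2]
    by_cases hij : i = j
    · simp [hij]
    · simp [hij, Ne.symm hij]
  have hc : Fintype.card ι = Fintype.card (L ≃ₐ[K] L) := by
    rw [← Module.finrank_eq_card_basis b, ← Nat.card_eq_fintype_card,
      IsGalois.card_aut_eq_finrank]
  have h3 : N * M = 1 := (Matrix.mul_eq_one_comm_of_card_eq (n := L ≃ₐ[K] L) (m := ι) (R := L) (eq := hc)).1 h1
  have h4 := congrFun (congrFun h3 1) g
  rw [Matrix.mul_apply, Matrix.one_apply] at h4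
  simpa [M, N, eq_comm] using h4

lemma descent_bij {K L : Type} [Field K] [Field L] [Algebra K L] [FiniteDimensional K L]
    [IsGalois K L] {V N : Type} [AddCommGroup V] [Module L V] [AddCommGroup N] [Module K N]
    (σ : (L ≃ₐ[K] L) → V → V) (hadd : ∀ g v w, σ g (v + w) = σ g v + σ g w)
    (hsmul : ∀ g (l : L) v, σ g (l • v) = g l • σ g v)
    (hmul : ∀ g h v, σ (g * h) v = σ g (σ h v)) (hone : ∀ v, σ 1 v = v)
    (j : N → V) (jadd : ∀ m n, j (m + n) = j m + j n)
    (jsmul : ∀ (k : K) n, j (k • n) = algebraMap K L k • j n)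
    (jinj : Function.Injective j) (jfix : ∀ v, (∃ n, j n = v) ↔ ∀ g, σ g v = v)
    (m : Module K L) (hm : m = Algebra.toModule)
    (Φ : @TensorProduct K _ L N _ _ m _ → V) (Φadd : ∀ x y, Φ (x + y) = Φ x + Φ y)
    (Φt : ∀ (l : L) (n : N), Φ (@TensorProduct.tmul K _ L N _ _ m _ l n) = l • j n) :
    Function.Bijective Φ := by
  classical
  subst hm
  let b := Module.finBasis K L
  have hT : ∀ i v, ∃ n, j n = ∑ g : L ≃ₐ[K] L, σ g (b.traceDual i • v) := by
    intro i v
    rw [jfix]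
    intro h
    have : ∀ s : Finset (L ≃ₐ[K] L), ∀ f : (L ≃ₐ[K] L) → V,
        σ h (∑ g ∈ s, f g) = ∑ g ∈ s, σ h (f g) := fun s f =>
      map_sum (AddMonoidHom.mk' (σ h) (hadd h)) f s
    rw [this]
    simp only [← hmul]
    exact Fintype.sum_equiv (Equiv.mulLeft h) _ _ (fun g => rfl)
  choose T hT using hT
  have Tadd : ∀ i v w, T i (v + w) = T i v + T i w := by
    intro i v w
    apply jinj
    simp only [jadd, hT, smul_add, hadd, Finset.sum_add_distrib]
  have jfix' : ∀ n g, σ g (j n) = j n := fun n => (jfix _).1 ⟨n, rfl⟩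
  have Tt : ∀ i (l : L) n, T i (l • j n) = Algebra.trace K L (b.traceDual i * l) • n := by
    intro i l n
    apply jinj
    rw [hT, jsmul, trace_eq_sum_automorphisms, Finset.sum_smul]
    simp only [smul_smul, hsmul, jfix']
  have key : ∀ x, ∑ i, b i ⊗ₜ[K] T i (Φ x) = x := by
    intro x
    induction x using TensorProduct.induction_on with
    | zero =>
      have h0 : Φ 0 = 0 := by simpa using Φadd 0 0
      have h1 : ∀ i, T i 0 = 0 := fun i => by simpa using Tadd i 0 0
      simp [h0, h1]
    | tmul l n =>
      simp only [Φt, Tt, TensorProduct.tmul_smul]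
      simp only [TensorProduct.smul_tmul', ← TensorProduct.sum_tmul]
      congr 1
      conv_rhs => rw [← b.sum_repr l]
      refine Finset.sum_congr rfl fun i _ => ?_
      congr 1
      have := b.traceDual.traceDual_repr_apply l i
      rw [Module.Basis.traceDual_traceDual] at this
      rw [this, Algebra.traceForm_apply, mul_comm]
    | add x y hx hy =>
      simp only [Φadd, Tadd, TensorProduct.tmul_add, Finset.sum_add_distrib, hx, hy]
  refine ⟨Function.LeftInverse.injective (g := fun v => ∑ i, b i ⊗ₜ[K] T i v) key, fun v => 
    ⟨∑ i, b i ⊗ₜ[K] T i v, ?_⟩⟩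
  rw [show Φ (∑ i, b i ⊗ₜ[K] T i v) = ∑ i, Φ (b i ⊗ₜ[K] T i v) from
    map_sum (AddMonoidHom.mk' Φ Φadd) _ _]
  simp only [Φt, hT, hsmul, Finset.smul_sum, smul_smul]
  rw [Finset.sum_comm]
  simp only [← Finset.sum_smul, gal_dual]
  simp [hone]

section
variable {K L : Type} [Field K] [Field L] [Algebra K L]
    {X : TopCat.{0}} (P : (Opens X)ᵒᵖ ⥤ ModuleCat.{0} L)
    (φ : ∀ g : L ≃ₐ[K] L, P ≅ P ⋙ ModuleCat.restrictScalars (g : L →+* L))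

/-- the semilinear action on sections -/
noncomputable def gact (g : L ≃ₐ[K] L) (U : (Opens X)ᵒᵖ) (s : P.obj U) : P.obj U := (φ g).hom.app U s

lemma gact_add (g : L ≃ₐ[K] L) (U : (Opens X)ᵒᵖ) (s t : P.obj U) :
    gact P φ g U (s + t) = gact P φ g U s + gact P φ g U t :=
  map_add ((φ g).hom.app U).hom s t

lemma gact_smul (g : L ≃ₐ[K] L) (U : (Opens X)ᵒᵖ) (l : L) (s : P.obj U) :
    gact P φ g U (l • s) = g l • gact P φ g U s :=
  map_smul ((φ g).hom.app U).hom l s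

lemma gact_inj (g : L ≃ₐ[K] L) (U : (Opens X)ᵒᵖ) : Function.Injective (gact P φ g U) := by
  intro s t h
  have h2 : ((φ g).inv.app U) ((φ g).hom.app U s) = ((φ g).inv.app U) ((φ g).hom.app U t) :=
    congrArg _ h
  simpa only [← ConcreteCategory.comp_apply, Iso.hom_inv_id_app, ConcreteCategory.id_apply] using h2

lemma gact_nat (g : L ≃ₐ[K] L) {U V : (Opens X)ᵒᵖ} (f : U ⟶ V) (s : P.obj U) :
    gact P φ g V (P.map f s) = P.map f (gact P φ g U s) :=
  ConcreteCategory.congr_hom ((φ g).hom.naturality f) s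

/-- fixed sections -/
noncomputable def fixedSub (U : (Opens X)ᵒᵖ) :
    Submodule K ((ModuleCat.restrictScalars (algebraMap K L)).obj (P.obj U)) where
  carrier := {s | ∀ g, gact P φ g U s = s}
  zero_mem' g := map_zero ((φ g).hom.app U).hom
  add_mem' {s t} hs ht g := by
    exact (gact_add P φ g U s t).trans (congrArg₂ _ (hs g) (ht g))
  smul_mem' k s hs g := by
    refine (gact_smul P φ g U (algebraMap K L k) s).trans ?_
    rw [hs g, AlgEquiv.commutes]
    rfl

/-- presheaf of fixed sections -/
noncomputable def fixedPre : (Opens X)ᵒᵖ ⥤ ModuleCat.{0} K where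
  obj U := ModuleCat.of K (fixedSub P φ U)
  map {U V} f := ModuleCat.ofHom
    ((((ModuleCat.restrictScalars (algebraMap K L)).map (P.map f)).hom).restrict
      (p := fixedSub P φ U) (q := fixedSub P φ V)
      (fun s hs g => (gact_nat P φ g f s).trans (congrArg _ (hs g))))
  map_id U := by
    ext s
    exact ConcreteCategory.congr_hom (P.map_id U) s.1
  map_comp f g := by
    ext s
    exact ConcreteCategory.congr_hom (P.map_comp f g) s.1

/-- inclusion -/
noncomputable def fixedInc : fixedPre P φ ⟶ P ⋙ ModuleCat.restrictScalars (algebraMap K L) where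
  app U := ModuleCat.ofHom (Y := (ModuleCat.restrictScalars (algebraMap K L)).obj (P.obj U))
    (fixedSub P φ U).subtype
  naturality U V f := rfl

lemma fixedPre_isSheaf (hP : TopCat.Presheaf.IsSheaf P) :
    TopCat.Presheaf.IsSheaf (fixedPre P φ) := by
  rw [TopCat.Presheaf.isSheaf_iff_isSheafUniqueGluing]
  intro ι U sf hsf
  let F : X.Sheaf (ModuleCat L) := ⟨P, hP⟩
  obtain ⟨s, hs, hu⟩ := F.existsUnique_gluing U (fun i => ((sf i).1 : P.obj _))
    (fun i j => congrArg Subtype.val (hsf i j))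
  refine ⟨⟨s, fun g => ?_⟩, fun i => Subtype.ext (hs i), fun t ht => Subtype.ext ?_⟩
  · apply hu
    intro i
    refine (gact_nat P φ g _ s).symm.trans ?_
    have h := hs i
    refine (congrArg (gact P φ g _) h).trans ?_
    exact (sf i).2 g
  · exact hu _ fun i => congrArg Subtype.val (ht i)

/-- the comparison morphism -/
noncomputable def compar (N : (Opens X)ᵒᵖ ⥤ ModuleCat.{0} K)
    (ι : N ⟶ P ⋙ ModuleCat.restrictScalars (algebraMap K L)) :
    N ⋙ ModuleCat.extendScalars (algebraMap K L) ⟶ P where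
  app U := ((ModuleCat.extendRestrictScalarsAdj (algebraMap K L)).homEquiv _ _).symm (ι.app U)
  naturality U V f := by
    have := ι.naturality f
    dsimp at this ⊢
    rw [← Adjunction.homEquiv_naturality_left_symm, this,
      Adjunction.homEquiv_naturality_right_symm]

end

/-- **Galois descent for sheaves.** Let `L/K` be a finite Galois extension with Galois
group `G = L ≃ₐ[K] L`, `X` a topological space and `F` a sheaf of `L`-vector spaces on
`X` equipped with a `G`-structure: isomorphisms `φ g : F ≅ conj_g F` (where
`conj_g F = F ⋙ restriction of scalars along g`) satisfying the cocycle condition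
`φ (g·h) = conj_h (φ g) ∘ φ h`, i.e. sectionwise `(φ (g·h))^U = (φ g)^U ∘ (φ h)^U`.
Let `F_K` be the subsheaf of `K`-vector spaces of `G`-fixed sections,
`F_K(U) = {s ∈ F(U) : (φ g)^U s = s for all g}` (realized as a sheaf `FK` of `K`-vector
spaces with an injective morphism `ι` into the restriction of scalars of `F` whose image
consists of the fixed sections).  Then for every open `U` the natural `L`-linear map
`L ⊗[K] F_K(U) → F(U)`, `l ⊗ s ↦ l • ι s`, is an isomorphism; in particular `F` is
isomorphic, as a sheaf of `L`-vector spaces, to the extension of scalars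
`U ↦ L ⊗[K] F_K(U)` of `F_K` from `K` to `L`, i.e. `F` has a `K`-structure. -/
theorem gStructure_descent_sheaf
    {K L : Type} [Field K] [Field L] [Algebra K L] [FiniteDimensional K L] [IsGalois K L]
    {X : TopCat.{0}} (F : X.Sheaf (ModuleCat L))
    (φ : ∀ g : L ≃ₐ[K] L, F.val ≅ F.val ⋙ ModuleCat.restrictScalars (g : L →+* L))
    (hφ : ∀ (g h : L ≃ₐ[K] L) (U : (Opens X)ᵒᵖ) (s : F.val.obj U),
      ((φ (g * h)).hom.app U s : F.val.obj U)
        = (φ g).hom.app U (((φ h).hom.app U s : F.val.obj U))) :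
    ∃ (FK : X.Sheaf (ModuleCat K))
      (ι : FK.val ⟶ F.val ⋙ ModuleCat.restrictScalars (algebraMap K L)),
      (∀ U, Function.Injective (ι.app U)) ∧
      (∀ (U : (Opens X)ᵒᵖ) (s : F.val.obj U),
        (∃ t, (ι.app U t : F.val.obj U) = s)
          ↔ ∀ g : L ≃ₐ[K] L, ((φ g).hom.app U s : F.val.obj U) = s) ∧
      (∀ U : (Opens X)ᵒᵖ, ∃ ψ : L ⊗[K] (FK.val.obj U) →ₗ[L] F.val.obj U,
        (∀ (l : L) (t : FK.val.obj U),
          ψ (l ⊗ₜ[K] t) = l • (show (F.val.obj U : Type) from ι.app U t)) ∧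
        Function.Bijective ψ) ∧
      Nonempty ((FK.val ⋙ ModuleCat.extendScalars (algebraMap K L)) ≅ F.val) := by
  have hone : ∀ U s, gact F.val φ 1 U s = s := fun U s =>
    gact_inj F.val φ 1 U ((hφ 1 1 U s).symm.trans (by rw [mul_one]; rfl))
  have fixiff : ∀ (U : (Opens X)ᵒᵖ) (s : F.val.obj U),
      (∃ t : fixedSub F.val φ U, (t.1 : F.val.obj U) = s) ↔ ∀ g, gact F.val φ g U s = s :=
    fun U s => ⟨by rintro ⟨t, rfl⟩; exact t.2, fun h => ⟨⟨s, h⟩, rfl⟩⟩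
  have bij := fun (U : (Opens X)ᵒᵖ) => descent_bij (V := F.val.obj U) (N := fixedSub F.val φ U)
    (fun g => gact F.val φ g U)
    (fun g => gact_add F.val φ g U) (fun g => gact_smul F.val φ g U)
    (fun g h s => hφ g h U s) (hone U) (fun t => t.1) (fun _ _ => rfl) (fun _ _ => rfl)
    Subtype.val_injective (fixiff U)
  refine ⟨⟨fixedPre F.val φ, fixedPre_isSheaf F.val φ F.property⟩, fixedInc F.val φ,
    fun U => Subtype.val_injective, fixiff, fun U => ?_, ?_⟩
  · let _ : Module K (F.val.obj U) := Module.compHom _ (algebraMap K L)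
    have : IsScalarTower K L (F.val.obj U) := ⟨fun k l v => by
      rw [Algebra.smul_def, mul_smul]; rfl⟩
    let j : fixedSub F.val φ U →ₗ[K] F.val.obj U :=
      { toFun := fun t => t.1, map_add' := fun _ _ => rfl, map_smul' := fun _ _ => rfl }
    refine ⟨TensorProduct.AlgebraTensorModule.lift
      ((LinearMap.toSpanSingleton L (fixedSub F.val φ U →ₗ[K] F.val.obj U) j)), ?_, ?_⟩
    · intro l t
      rfl
    · exact bij U _ rfl _ (map_add _) (fun l t => rfl)
  · have : ∀ U, IsIso ((compar F.val _ (fixedInc F.val φ)).app U) := by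
      intro U
      rw [ConcreteCategory.isIso_iff_bijective]
      refine bij U _ ?_ (fun x => (compar F.val _ (fixedInc F.val φ)).app U x)
        (map_add ((compar F.val _ (fixedInc F.val φ)).app U).hom) (fun l t => rfl)
      refine Module.ext (funext₂ fun k l => ?_)
      exact (Algebra.smul_def (R := K) (A := L) k l).symm
    have := NatIso.isIso_of_isIso_app (compar F.val _ (fixedInc F.val φ))
    exact ⟨asIso (compar F.val _ (fixedInc F.val φ))⟩
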